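/- arXiv:2404.12936 — 4 statements merged into one kernel-verified Lean document; each statement's English description precedes it below -/
import Mathlib

section
/- Let p be a prime, let Q = [a,b,c] be a binary quadratic form in 𝓕_p, and let γ ∈ SL₂(ℤ). Then Q⋆γ ∈ 𝓕_p if and only if γ ∈ Γ₀(p). In particular, the ⋆-action of Γ₀(p) preserves the set 𝓕_p. -/
open Matrix MvPolynomial

/-- `SL(2,ℤ)` -/
abbrev SL2Z := Matrix.SpecialLinearGroup (Fin 2) ℤ

/-- The discriminant of the binary quadratic form `[a,b,c]`, encoded as `(a,b,c)`. -/
def discBQF (Q : ℤ × ℤ × ℤ) : ℤ := Q.2.1 ^ 2 - 4 * Q.1 * Q.2.2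

/-- The right ⋆-action of `SL(2,ℤ)` on binary quadratic forms:
`(Q ⋆ γ)(x,y) = Q(δx - γ₀y, -βx + αy)` for `γ = [[α,β],[γ₀,δ]]`, written on coefficients. -/
def starBQF (Q : ℤ × ℤ × ℤ) (g : SL2Z) : ℤ × ℤ × ℤ :=
  (Q.1 * (g.1 1 1) ^ 2 - Q.2.1 * (g.1 0 1) * (g.1 1 1) + Q.2.2 * (g.1 0 1) ^ 2,
   -2 * Q.1 * (g.1 1 0) * (g.1 1 1) + Q.2.1 * ((g.1 0 0) * (g.1 1 1) + (g.1 0 1) * (g.1 1 0))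
     - 2 * Q.2.2 * (g.1 0 0) * (g.1 0 1),
   Q.1 * (g.1 1 0) ^ 2 - Q.2.1 * (g.1 0 0) * (g.1 1 0) + Q.2.2 * (g.1 0 0) ^ 2)

/-- Membership in the set `𝓕_p`: positive discriminant, `p ∤ a`, `p ∣ b`, `p ∣ c`. -/
def memF (p : ℕ) (Q : ℤ × ℤ × ℤ) : Prop :=
  0 < discBQF Q ∧ ¬ (p : ℤ) ∣ Q.1 ∧ (p : ℤ) ∣ Q.2.1 ∧ (p : ℤ) ∣ Q.2.2

/-- A binary quadratic form `[a,b,c]` regarded as the homogeneous polynomial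
`a·X² + b·X·Y + c·Y²` of degree 2 over `K`. -/
noncomputable def bqfPoly (K : Type*) [Field K] (Q : ℤ × ℤ × ℤ) : MvPolynomial (Fin 2) K :=
  C (Q.1 : K) * X 0 ^ 2 + C (Q.2.1 : K) * X 0 * X 1 + C (Q.2.2 : K) * X 1 ^ 2

/-- Substitution of variables along an integer 2×2 matrix:
`h(X,Y) ↦ h(m₀₀X + m₀₁Y, m₁₀X + m₁₁Y)`. -/
noncomputable def substMat (K : Type*) [Field K] (m : Matrix (Fin 2) (Fin 2) ℤ)
    (h : MvPolynomial (Fin 2) K) : MvPolynomial (Fin 2) K :=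
  aeval ![C ((m 0 0 : ℤ) : K) * X 0 + C ((m 0 1 : ℤ) : K) * X 1,
          C ((m 1 0 : ℤ) : K) * X 0 + C ((m 1 1 : ℤ) : K) * X 1] h

/-- The `|`-action: `(h|γ)(X,Y) = h(aX + bY, cX + dY)` for `γ = [[a,b],[c,d]]`. -/
noncomputable def actBar (K : Type*) [Field K] (g : SL2Z) (h : MvPolynomial (Fin 2) K) :
    MvPolynomial (Fin 2) K :=
  substMat K g.1 h

/-- The `⋆`-action: `(h⋆γ)(X,Y) = h(dX - cY, -bX + aY)` for `γ = [[a,b],[c,d]]`. -/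
noncomputable def actStar (K : Type*) [Field K] (g : SL2Z) (h : MvPolynomial (Fin 2) K) :
    MvPolynomial (Fin 2) K :=
  substMat K !![g.1 1 1, -(g.1 1 0); -(g.1 0 1), g.1 0 0] h

/-- The pairing `⟨·,·⟩` on homogeneous polynomials of degree `2k-2`, determined by
`⟨XⁱY^{2k-2-i}, XʲY^{2k-2-j}⟩ = (-1)ⁱ·binom(2k-2,i)⁻¹·δ_{j,2k-2-i}`. -/
noncomputable def pairingP (K : Type*) [Field K] (k : ℕ) (h g : MvPolynomial (Fin 2) K) : K :=
  ∑ i ∈ Finset.range (2 * k - 1),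
    (-1 : K) ^ i * (((2 * k - 2).choose i : K))⁻¹ *
      coeff (Finsupp.single 0 i + Finsupp.single 1 (2 * k - 2 - i)) h *
      coeff (Finsupp.single 0 (2 * k - 2 - i) + Finsupp.single 1 i) g

/-- The projective line `ℙ¹(ℚ)`, realized as the projectivization of `ℚ²`. -/
abbrev P1Q := Projectivization ℚ (Fin 2 → ℚ)

/-- The linear automorphism of `ℚ²` attached to `g ∈ SL(2,ℤ)`. -/
noncomputable def sl2LinEquiv (g : SL2Z) : (Fin 2 → ℚ) ≃ₗ[ℚ] (Fin 2 → ℚ) :=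
  LinearMap.GeneralLinearGroup.toLinearEquiv
    (Matrix.GeneralLinearGroup.toLin
      (Matrix.SpecialLinearGroup.toGL
        (Matrix.SpecialLinearGroup.map (Int.castRingHom ℚ) g)))

/-- The Möbius action of `SL(2,ℤ)` on `ℙ¹(ℚ)`. -/
noncomputable def smulP1 (g : SL2Z) (x : P1Q) : P1Q :=
  Projectivization.map (sl2LinEquiv g).toLinearMap (sl2LinEquiv g).injective x

/-- The involution `r ↦ -r` of `ℙ¹(ℚ)` (induced by the matrix `w_∞ = [[-1,0],[0,1]]`). -/
noncomputable def negP1 (x : P1Q) : P1Q :=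
  Projectivization.map
    (LinearEquiv.ofInvolutive
      ({ toFun := fun v => ![-v 0, v 1]
         map_add' := by intro u v; funext i; fin_cases i <;> simp [Matrix.cons_val_zero, Matrix.cons_val_one] <;> ring
         map_smul' := by intro c v; funext i; fin_cases i <;> simp [Matrix.cons_val_zero, Matrix.cons_val_one] <;> ring } :
        (Fin 2 → ℚ) →ₗ[ℚ] (Fin 2 → ℚ))
      (by intro v; funext i; fin_cases i <;> simp)).toLinearMap
    (LinearEquiv.ofInvolutive _ _).injective x

/-- The action of `w_∞ = [[-1,0],[0,1]]` on polynomials for the `|`-convention: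
`(h|w_∞)(X,Y) = h(-X, Y)`. -/
noncomputable def actBarW (K : Type*) [Field K] (h : MvPolynomial (Fin 2) K) :
    MvPolynomial (Fin 2) K :=
  substMat K !![-1, 0; 0, 1] h

/-- The action of `w_∞` on polynomials for the `⋆`-convention: `(h⋆w_∞)(X,Y) = h(X, -Y)`. -/
noncomputable def actStarW (K : Type*) [Field K] (h : MvPolynomial (Fin 2) K) :
    MvPolynomial (Fin 2) K :=
  substMat K !![1, 0; 0, -1] h

/-- The matrix `S = [[0,1],[-1,0]]` as an element of `SL(2,ℤ)`. -/
def matS : SL2Z := ⟨!![0, 1; -1, 0], by norm_num [Matrix.det_fin_two_of]⟩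

/-- The conjugate `γ' = w_∞ γ w_∞` of `γ = [[α,β],[γ₀,δ]] ∈ SL(2,ℤ)`,
given by `[[α,-β],[-γ₀,δ]]`. -/
def conjW (g : SL2Z) : SL2Z :=
  ⟨!![g.1 0 0, -(g.1 0 1); -(g.1 1 0), g.1 1 1], by
    have h2 : g.1.det = 1 := g.2
    rw [Matrix.det_fin_two] at h2
    rw [Matrix.det_fin_two_of]
    linarith⟩

/-- For `Q ∈ 𝓕_p` and `γ ∈ SL₂(ℤ)`, `Q⋆γ ∈ 𝓕_p` iff `γ ∈ Γ₀(p)`;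
in particular the ⋆-action of `Γ₀(p)` preserves `𝓕_p`. -/
theorem star_mem_F_iff_Gamma0 (p : ℕ) (hp : p.Prime) (Q : ℤ × ℤ × ℤ) (hQ : memF p Q)
    (γ : SL2Z) :
    memF p (starBQF Q γ) ↔ (p : ℤ) ∣ γ.1 1 0 := by
  obtain ⟨a, b, c⟩ := Q
  have hdet : γ.1 0 0 * γ.1 1 1 - γ.1 0 1 * γ.1 1 0 = 1 := by
    have h2 : γ.1.det = 1 := γ.2
    rwa [Matrix.det_fin_two] at h2
  have hpp : Prime (p : ℤ) := Nat.prime_iff_prime_int.mp hp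
  unfold memF discBQF at *
  unfold starBQF
  dsimp only at *
  generalize γ.1 0 0 = α at *
  generalize γ.1 0 1 = β at *
  generalize γ.1 1 0 = g at *
  generalize γ.1 1 1 = δ at *
  obtain ⟨hD, ha, ⟨b', rfl⟩, ⟨c', rfl⟩⟩ := hQ
  constructor
  · rintro ⟨-, -, -, h⟩
    have h1 : (p : ℤ) ∣ a * g ^ 2 := by
      have e : a * g ^ 2 = (a * g ^ 2 - p * b' * α * g + p * c' * α ^ 2)
          + p * (b' * α * g - c' * α ^ 2) := by ring
      rw [e]
      exact dvd_add h (dvd_mul_right _ _)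
    exact hpp.dvd_of_dvd_pow ((hpp.dvd_or_dvd h1).resolve_left ha)
  · rintro ⟨g', rfl⟩
    refine ⟨?_, ?_, ?_, ?_⟩
    · have key : 0 < ((p * b') ^ 2 - 4 * a * (p * c')) * (α * δ - β * (p * g')) ^ 2 := by
        rw [hdet]
        simpa using hD
      convert key using 1
      ring
    · intro h
      have h1 : (p : ℤ) ∣ a * δ ^ 2 := by
        have e : a * δ ^ 2 = (a * δ ^ 2 - p * b' * β * δ + p * c' * β ^ 2)
            + p * (b' * β * δ - c' * β ^ 2) := by ring
        rw [e]
        exact dvd_add h (dvd_mul_right _ _)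
      have h3 : (p : ℤ) ∣ δ := hpp.dvd_of_dvd_pow ((hpp.dvd_or_dvd h1).resolve_left ha)
      apply hpp.not_dvd_one
      rw [← hdet]
      exact dvd_sub (Dvd.dvd.mul_left h3 _) ⟨β * g', by ring⟩
    · exact ⟨-2 * a * g' * δ + b' * (α * δ + β * (p * g')) - 2 * c' * α * β, by ring⟩
    · exact ⟨a * p * g' ^ 2 - p * b' * α * g' + c' * α ^ 2, by ring⟩
end

section
/- Let p be a prime and let Q ∈ 𝓕_p. Then every γ ∈ SL₂(ℤ) satisfying Q⋆γ = Q lies in Γ₀(p); i.e., the stabilizer of Q in SL₂(ℤ) for the ⋆-action is contained in Γ₀(p). -/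
open Matrix MvPolynomial

/-- For `Q ∈ 𝓕_p`, any `γ ∈ SL₂(ℤ)` with `Q⋆γ = Q` lies in `Γ₀(p)`. -/
theorem stabilizer_subset_Gamma0 (p : ℕ) (hp : p.Prime) (Q : ℤ × ℤ × ℤ) (hQ : memF p Q)
    (γ : SL2Z) (hfix : starBQF Q γ = Q) :
    (p : ℤ) ∣ γ.1 1 0 := by
  obtain ⟨a, b, c⟩ := Q
  obtain ⟨_, ha, hb, hc⟩ := hQ
  have h3 := congrArg (fun q : ℤ × ℤ × ℤ => q.2.2) hfix
  simp only [starBQF] at ha hb hc h3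
  have hpi : Prime (p : ℤ) := Nat.prime_iff_prime_int.mp hp
  have h : (p : ℤ) ∣ a * (γ.1 1 0) ^ 2 := by
    have e : a * (γ.1 1 0) ^ 2
        = c + b * (γ.1 0 0 * γ.1 1 0) - c * (γ.1 0 0) ^ 2 := by linarith
    rw [e]
    exact dvd_sub (dvd_add hc (hb.mul_right _)) (hc.mul_right _)
  exact hpi.dvd_of_dvd_pow ((hpi.dvd_or_dvd h).resolve_left ha)
end

section
/- Let μ be a Γ₀(p)-invariant P_{2k−2}(K)-valued modular symbol for the ⋆-action, let Q ∈ 𝓕_p, and let γ ∈ Γ₀(p) satisfy Q⋆γ = Q. Then the quantity ⟨μ{ω, γω}, Q^{k−1}⟩ is independent of the base point: ⟨μ{ω, γω}, Q^{k−1}⟩ = ⟨μ{ω′, γω′}, Q^{k−1}⟩ for all ω, ω′ ∈ ℙ¹(ℚ). -/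
open Matrix MvPolynomial

/-- The monomial expression `c X^i Y^j`. -/
lemma aux_mono {K : Type*} [Field K] (c : K) (i j : ℕ) :
    (C c * X 0 ^ i * X 1 ^ j : MvPolynomial (Fin 2) K) =
      monomial (Finsupp.single 0 i + Finsupp.single 1 j) c := by
  rw [X_pow_eq_monomial, X_pow_eq_monomial, C_apply, monomial_mul, monomial_mul]
  simp

lemma aux_inj (n i j : ℕ) :
    ((Finsupp.single 0 j + Finsupp.single 1 (n - j) : Fin 2 →₀ ℕ) =
      Finsupp.single 0 i + Finsupp.single 1 (n - i)) ↔ j = i := by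
  constructor
  · intro h
    have := DFunLike.congr_fun h 0
    simpa using this
  · rintro rfl; rfl

lemma aux_coeff {K : Type*} [Field K] (n : ℕ) (a : ℕ → K) (i : ℕ) (hi : i ≤ n) :
    coeff (Finsupp.single 0 i + Finsupp.single 1 (n - i))
      (∑ j ∈ Finset.range (n + 1),
        (C (a j) * X 0 ^ j * X 1 ^ (n - j) : MvPolynomial (Fin 2) K)) = a i := by
  rw [coeff_sum]
  simp only [aux_mono, coeff_monomial, aux_inj]
  rw [Finset.sum_ite_eq' (Finset.range (n + 1)) i a]
  rw [if_pos (by simp; omega)]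

lemma aux_decomp {K : Type*} [Field K] (n : ℕ) (h : MvPolynomial (Fin 2) K)
    (hh : h.IsHomogeneous n) :
    h = ∑ j ∈ Finset.range (n + 1),
      C (coeff (Finsupp.single 0 j + Finsupp.single 1 (n - j)) h) * X 0 ^ j * X 1 ^ (n - j) := by
  ext d
  have hd : d = Finsupp.single 0 (d 0) + Finsupp.single 1 (d 1) := by
    ext x; fin_cases x <;> simp
  by_cases hdn : d 0 + d 1 = n
  · have h1 : d 1 = n - d 0 := by omega
    rw [h1] at hd
    rw [hd, aux_coeff n _ (d 0) (by omega)]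
  · rw [hh.coeff_eq_zero, coeff_sum]
    · symm
      apply Finset.sum_eq_zero
      intro j hj
      rw [aux_mono, coeff_monomial, if_neg]
      rintro rfl
      apply hdn
      simp at hj ⊢
      omega
    · rw [Finsupp.degree_eq_sum]
      simpa using hdn

lemma aux_lin_pow {K : Type*} [Field K] (n : ℕ) (u v : K) :
    ((C u * X 0 + C v * X 1) ^ n : MvPolynomial (Fin 2) K) =
      ∑ j ∈ Finset.range (n + 1),
        C (u ^ j * v ^ (n - j) * (n.choose j : K)) * X 0 ^ j * X 1 ^ (n - j) := by
  rw [add_pow]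
  apply Finset.sum_congr rfl
  intro j _
  simp only [C_mul, C_pow, map_natCast]
  ring

/-- The pairing in degree `n`. -/
noncomputable def pairN (K : Type*) [Field K] (n : ℕ) (h g : MvPolynomial (Fin 2) K) : K :=
  ∑ i ∈ Finset.range (n + 1),
    (-1 : K) ^ i * ((n.choose i : K))⁻¹ *
      coeff (Finsupp.single 0 i + Finsupp.single 1 (n - i)) h *
      coeff (Finsupp.single 0 (n - i) + Finsupp.single 1 i) g

lemma pairN_add {K : Type*} [Field K] (n : ℕ) (h h' g : MvPolynomial (Fin 2) K) :
    pairN K n (h + h') g = pairN K n h g + pairN K n h' g := by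
  simp only [pairN, coeff_add, ← Finset.sum_add_distrib]
  apply Finset.sum_congr rfl
  intro i _
  ring

lemma pairN_smul {K : Type*} [Field K] (n : ℕ) (c : K) (h g : MvPolynomial (Fin 2) K) :
    pairN K n (c • h) g = c * pairN K n h g := by
  simp only [pairN, coeff_smul, Finset.mul_sum, smul_eq_mul]
  apply Finset.sum_congr rfl
  intro i _
  ring

/-- The pairing as a linear functional of its first argument. -/
noncomputable def pairLin (K : Type*) [Field K] (n : ℕ) (g : MvPolynomial (Fin 2) K) :
    MvPolynomial (Fin 2) K →ₗ[K] K where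
  toFun h := pairN K n h g
  map_add' h h' := pairN_add n h h' g
  map_smul' c h := by simpa using pairN_smul n c h g

lemma pairN_lin_pow {K : Type*} [Field K] [CharZero K] (n : ℕ) (u v : K)
    (g : MvPolynomial (Fin 2) K) (hg : g.IsHomogeneous n) :
    pairN K n ((C u * X 0 + C v * X 1) ^ n) g = eval ![v, -u] g := by
  conv_rhs => rw [aux_decomp n g hg]
  rw [map_sum, ← Finset.sum_range_reflect, pairN]
  apply Finset.sum_congr rfl
  intro i hi
  have hi' : i ≤ n := by simp at hi; omega
  rw [aux_lin_pow, aux_coeff n _ i hi']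
  have hc : (n.choose i : K) ≠ 0 := by
    exact_mod_cast (Nat.choose_pos hi').ne'
  have h1 : n + 1 - 1 - i = n - i := by omega
  have h2 : n - (n - i) = i := by omega
  rw [h1, h2]
  simp
  rw [neg_pow u i]
  field_simp

/-- A linear functional vanishing on powers of linear forms vanishes in degree `n`. -/
lemma aux_vanish {K : Type*} [Field K] [CharZero K] (n : ℕ)
    (L : MvPolynomial (Fin 2) K →ₗ[K] K)
    (hL : ∀ u v : K, L ((C u * X 0 + C v * X 1) ^ n) = 0)
    (h : MvPolynomial (Fin 2) K) (hh : h.IsHomogeneous n) : L h = 0 := by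
  have key : ∀ (c : K) (j : ℕ), (C c * X 0 ^ j * X 1 ^ (n - j) : MvPolynomial (Fin 2) K) =
      c • (X 0 ^ j * X 1 ^ (n - j)) := by
    intro c j
    rw [smul_eq_C_mul, mul_assoc]
  let P : Polynomial K := ∑ j ∈ Finset.range (n + 1),
    Polynomial.monomial j ((n.choose j : K) * L (X 0 ^ j * X 1 ^ (n - j)))
  have hP : P = 0 := by
    apply Polynomial.funext
    intro u
    have := hL u 1
    rw [aux_lin_pow, map_sum] at this
    simp only [key, map_smul, smul_eq_mul, one_pow, mul_one] at this
    simp only [P, Polynomial.eval_finset_sum, Polynomial.eval_monomial, Polynomial.eval_zero]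
    rw [← this]
    apply Finset.sum_congr rfl
    intro i _
    ring
  rw [aux_decomp n h hh, map_sum]
  apply Finset.sum_eq_zero
  intro j hj
  have hc : (n.choose j : K) ≠ 0 := by
    have : j ≤ n := by simp at hj; omega
    exact_mod_cast (Nat.choose_pos this).ne'
  have h0 : P.coeff j = 0 := by rw [hP]; simp
  simp only [P, Polynomial.finset_sum_coeff, Polynomial.coeff_monomial] at h0
  rw [Finset.sum_ite_eq' (Finset.range (n + 1)) j, if_pos hj] at h0
  have h1 := (mul_eq_zero.mp h0).resolve_left hc
  rw [key, map_smul, h1, smul_zero]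

/-- `substMat` as an algebra homomorphism. -/
noncomputable def substHom (K : Type*) [Field K] (m : Matrix (Fin 2) (Fin 2) ℤ) :
    MvPolynomial (Fin 2) K →ₐ[K] MvPolynomial (Fin 2) K :=
  aeval ![C ((m 0 0 : ℤ) : K) * X 0 + C ((m 0 1 : ℤ) : K) * X 1,
          C ((m 1 0 : ℤ) : K) * X 0 + C ((m 1 1 : ℤ) : K) * X 1]

lemma eval_subst {K : Type*} [Field K] (m : Matrix (Fin 2) (Fin 2) ℤ) (x y : K)
    (g : MvPolynomial (Fin 2) K) :
    eval ![x, y] (substHom K m g) =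
      eval ![(m 0 0 : K) * x + (m 0 1 : K) * y, (m 1 0 : K) * x + (m 1 1 : K) * y] g := by
  induction g using MvPolynomial.induction_on with
  | C a => simp [substHom]
  | add p q hp hq => simp [hp, hq]
  | mul_X p i hp =>
    rw [map_mul, map_mul, map_mul, hp]
    congr 1
    fin_cases i <;> simp [substHom]

lemma pairN_invariant {K : Type*} [Field K] [CharZero K] (n : ℕ)
    (m : Matrix (Fin 2) (Fin 2) ℤ) (hm : m 0 0 * m 1 1 - m 0 1 * m 1 0 = 1)
    (g : MvPolynomial (Fin 2) K) (hg : g.IsHomogeneous n) (hfix : substHom K m g = g)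
    (h : MvPolynomial (Fin 2) K) (hh : h.IsHomogeneous n) :
    pairN K n (substHom K m h) g = pairN K n h g := by
  have hmK : (m 0 0 : K) * m 1 1 - m 0 1 * m 1 0 = 1 := by exact_mod_cast congrArg (Int.cast : ℤ → K) hm
  have := aux_vanish n ((pairLin K n g).comp (substHom K m).toLinearMap - pairLin K n g) (by
    intro u v
    have e : substHom K m ((C u * X 0 + C v * X 1) ^ n) =
        (C (u * m 0 0 + v * m 1 0) * X 0 + C (u * m 0 1 + v * m 1 1) * X 1) ^ n := by
      rw [map_pow]
      congr 1
      simp [substHom]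
      ring
    simp only [LinearMap.sub_apply, LinearMap.comp_apply, AlgHom.toLinearMap_apply]
    rw [e]
    change pairN K n _ g - pairN K n _ g = 0
    rw [pairN_lin_pow n _ _ g hg, pairN_lin_pow n _ _ g hg, sub_eq_zero]
    conv_lhs => rw [← hfix]
    rw [eval_subst]
    congr 2
    have e1 : (m 0 0 : K) * (u * m 0 1 + v * m 1 1) + m 0 1 * -(u * m 0 0 + v * m 1 0) = v := by
      linear_combination v * hmK
    have e2 : (m 1 0 : K) * (u * m 0 1 + v * m 1 1) + m 1 1 * -(u * m 0 0 + v * m 1 0) = -u := by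
      linear_combination -u * hmK
    rw [e1, e2]) h hh
  exact sub_eq_zero.mp this

lemma bqfPoly_homog (K : Type*) [Field K] (Q : ℤ × ℤ × ℤ) :
    (bqfPoly K Q).IsHomogeneous 2 := by
  have hC : ∀ a : K, (C a : MvPolynomial (Fin 2) K).IsHomogeneous 0 := fun a =>
    isHomogeneous_C _ a
  have hX : ∀ i, (X i : MvPolynomial (Fin 2) K).IsHomogeneous 1 := fun i => isHomogeneous_X _ i
  exact (((hC _).mul ((hX 0).pow 2)).add (((hC _).mul (hX 0)).mul (hX 1))).add
    ((hC _).mul ((hX 1).pow 2))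

lemma bqfPoly_star (K : Type*) [Field K] (Q : ℤ × ℤ × ℤ) (g : SL2Z) :
    substHom K !![g.1 1 1, -(g.1 1 0); -(g.1 0 1), g.1 0 0] (bqfPoly K Q) =
      bqfPoly K (starBQF Q g) := by
  have h2 : (C 2 : MvPolynomial (Fin 2) K) = 2 := map_ofNat C 2
  simp [substHom, bqfPoly, starBQF, h2]
  ring

/-- for a `Γ₀(p)`-invariant `P_{2k-2}(K)`-valued modular symbol `μ` (⋆-action),
`Q ∈ 𝓕_p` and `γ ∈ Γ₀(p)` with `Q⋆γ = Q`, the quantity `⟨μ{ω, γω}, Q^{k-1}⟩` does not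
depend on the base point `ω ∈ ℙ¹(ℚ)`. -/
theorem pairing_base_point_independent (p k : ℕ) (hp : p.Prime) (hk : 1 ≤ k)
    (K : Type*) [Field K] [CharZero K]
    (μ : P1Q → P1Q → MvPolynomial (Fin 2) K)
    (hsym : ∀ r s t : P1Q, μ r s + μ s t = μ r t)
    (hval : ∀ r s : P1Q, (μ r s).IsHomogeneous (2 * k - 2))
    (hinv : ∀ γ : SL2Z, (p : ℤ) ∣ γ.1 1 0 →
      ∀ r s : P1Q, actStar K γ (μ (smulP1 γ r) (smulP1 γ s)) = μ r s)
    (Q : ℤ × ℤ × ℤ) (hQ : memF p Q)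
    (γ : SL2Z) (hγ : (p : ℤ) ∣ γ.1 1 0) (hfix : starBQF Q γ = Q)
    (ω ω' : P1Q) :
    pairingP K k (μ ω (smulP1 γ ω)) (bqfPoly K Q ^ (k - 1)) =
      pairingP K k (μ ω' (smulP1 γ ω')) (bqfPoly K Q ^ (k - 1)) := by
  have e1 : 2 * k - 1 = (2 * k - 2) + 1 := by omega
  have hpair : ∀ h g, pairingP K k h g = pairN K (2 * k - 2) h g := by
    intro h g
    rw [pairingP, pairN, e1]
  have hg : (bqfPoly K Q ^ (k - 1)).IsHomogeneous (2 * k - 2) := by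
    have := (bqfPoly_homog K Q).pow (k - 1)
    have e2 : 2 * (k - 1) = 2 * k - 2 := by omega
    rwa [e2] at this
  have hgfix : substHom K !![γ.1 1 1, -(γ.1 1 0); -(γ.1 0 1), γ.1 0 0] (bqfPoly K Q ^ (k - 1)) =
      bqfPoly K Q ^ (k - 1) := by
    rw [map_pow, bqfPoly_star, hfix]
  have hdet := γ.2
  rw [Matrix.det_fin_two] at hdet
  have key := pairN_invariant (2 * k - 2) !![γ.1 1 1, -(γ.1 1 0); -(γ.1 0 1), γ.1 0 0]
    (by simp; linarith) _ hg hgfix _ (hval (smulP1 γ ω') (smulP1 γ ω))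
  have hi : substHom K !![γ.1 1 1, -(γ.1 1 0); -(γ.1 0 1), γ.1 0 0]
      (μ (smulP1 γ ω') (smulP1 γ ω)) = μ ω' ω := hinv γ hγ ω' ω
  rw [hi] at key
  rw [hpair, hpair]
  have h1 := hsym ω' ω (smulP1 γ ω)
  have h2 := hsym ω' (smulP1 γ ω') (smulP1 γ ω)
  have h3 := congrArg (fun h => pairN K (2 * k - 2) h (bqfPoly K Q ^ (k - 1))) (h1.trans h2.symm)
  simp only [pairN_add] at h3
  rw [key] at h3
  linear_combination h3
end

section
/- Let μ be a Γ₀(p)-invariant P_{2k−2}(K)-valued modular symbol for the ⋆-action, let Q ∈ 𝓕_p, let γ₀ ∈ Γ₀(p) satisfy Q⋆γ₀ = Q, and let γ ∈ Γ₀(p). Then γ⁻¹γ₀γ stabilizes Q⋆γ, i.e. (Q⋆γ)⋆(γ⁻¹γ₀γ) = Q⋆γ, and for all ω, ω′ ∈ ℙ¹(ℚ), ⟨μ{ω, (γ⁻¹γ₀γ)ω}, (Q⋆γ)^{k−1}⟩ = ⟨μ{ω′, γ₀ω′}, Q^{k−1}⟩. (This is the non-square-discriminant case of the statement that Î_k(J,Q)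 depends only on the Γ₀(p)-orbit of Q.) -/
open Matrix MvPolynomial

lemma oi_homog_sum {K : Type*} [Field K] {n : ℕ} {h : MvPolynomial (Fin 2) K}
    (hh : h.IsHomogeneous n) :
    h = ∑ i ∈ Finset.range (n + 1), C (coeff (Finsupp.single 0 i + Finsupp.single 1 (n - i)) h) *
      (X 0 ^ i * X 1 ^ (n - i)) := by
  have hm : ∀ i ∈ Finset.range (n + 1),
      C (coeff (Finsupp.single 0 i + Finsupp.single 1 (n - i)) h) *
      (X 0 ^ i * X 1 ^ (n - i) : MvPolynomial (Fin 2) K) =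
      monomial (Finsupp.single 0 i + Finsupp.single 1 (n - i))
        (coeff (Finsupp.single 0 i + Finsupp.single 1 (n - i)) h) := by
    intro i _
    rw [X_pow_eq_monomial, X_pow_eq_monomial, monomial_mul, C_mul_monomial]
    simp
  rw [Finset.sum_congr rfl hm]
  ext d
  rw [coeff_sum]
  simp only [coeff_monomial]
  by_cases hd : d 0 + d 1 = n
  · have hd' : Finsupp.single 0 (d 0) + Finsupp.single 1 (n - d 0) = d := by
      ext j
      fin_cases j
      · simp
      · simp; omega
    rw [Finset.sum_eq_single (d 0)]
    · rw [if_pos hd', hd']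
    · intro b _ hb
      rw [if_neg]
      intro h2
      apply hb
      have := DFunLike.congr_fun h2 0
      simpa using this
    · intro h3
      exfalso
      apply h3
      simp
      omega
  · rw [Finset.sum_eq_zero]
    · apply hh.coeff_eq_zero
      rw [Finsupp.degree_eq_sum]
      simpa using hd
    · intro i hi
      rw [if_neg]
      intro h2
      apply hd
      rw [← h2]
      simp at hi ⊢
      omega

lemma oi_linpow {K : Type*} [Field K] (n : ℕ) (s t : K) :
    (C s * X 0 + C t * X 1 : MvPolynomial (Fin 2) K) ^ n =
    ∑ m ∈ Finset.range (n + 1), C ((n.choose m : K) * s ^ m * t ^ (n - m)) *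
      (X 0 ^ m * X 1 ^ (n - m)) := by
  rw [add_pow]
  refine Finset.sum_congr rfl fun m _ => ?_
  simp only [mul_pow, map_mul, map_pow, map_natCast]
  ring

lemma oi_coeff {K : Type*} [Field K] (n : ℕ) (s t : K) (i : ℕ) (hi : i ≤ n) :
    coeff (Finsupp.single 0 (n - i) + Finsupp.single 1 i)
      ((C s * X 0 + C t * X 1 : MvPolynomial (Fin 2) K) ^ n) =
    (n.choose i : K) * s ^ (n - i) * t ^ i := by
  rw [oi_linpow, coeff_sum, Finset.sum_eq_single (n - i)]
  · rw [X_pow_eq_monomial, X_pow_eq_monomial, monomial_mul, C_mul_monomial, coeff_monomial,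
      Nat.sub_sub_self hi, if_pos rfl, Nat.choose_symm hi]
    ring
  · intro b _ hb
    rw [X_pow_eq_monomial, X_pow_eq_monomial, monomial_mul, C_mul_monomial, coeff_monomial,
      if_neg]
    intro h2
    apply hb
    have := DFunLike.congr_fun h2 0
    simpa using this
  · intro h3
    exfalso
    apply h3
    simp

lemma oi_pair_pow {K : Type*} [Field K] [CharZero K] (k : ℕ) (hk : 1 ≤ k)
    {h : MvPolynomial (Fin 2) K} (hh : h.IsHomogeneous (2 * k - 2)) (s t : K) :
    pairingP K k h ((C s * X 0 + C t * X 1) ^ (2 * k - 2)) = aeval ![-t, s] h := by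
  have e : 2 * k - 1 = (2 * k - 2) + 1 := by omega
  conv_rhs => rw [oi_homog_sum hh]
  rw [pairingP, e, map_sum]
  refine Finset.sum_congr rfl fun i hi => ?_
  have hi' : i ≤ 2 * k - 2 := by simp at hi; omega
  rw [oi_coeff _ _ _ _ hi']
  have hc : ((2 * k - 2).choose i : K) ≠ 0 := by
    exact_mod_cast (Nat.choose_pos hi').ne'
  simp only [map_mul, map_pow, aeval_X, aeval_C, Algebra.algebraMap_self, RingHom.id_apply,
    Matrix.cons_val_zero, Matrix.cons_val_one]
  rw [neg_pow t]
  field_simp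

lemma oi_pair_add_left {K : Type*} [Field K] (k : ℕ) (a b g : MvPolynomial (Fin 2) K) :
    pairingP K k (a + b) g = pairingP K k a g + pairingP K k b g := by
  simp only [pairingP, coeff_add, ← Finset.sum_add_distrib]
  exact Finset.sum_congr rfl fun i _ => by ring

lemma oi_pair_add_right {K : Type*} [Field K] (k : ℕ) (h a b : MvPolynomial (Fin 2) K) :
    pairingP K k h (a + b) = pairingP K k h a + pairingP K k h b := by
  simp only [pairingP, coeff_add, ← Finset.sum_add_distrib]
  exact Finset.sum_congr rfl fun i _ => by ring

lemma oi_pair_smul_right {K : Type*} [Field K] (k : ℕ) (h a : MvPolynomial (Fin 2) K) (c : K) :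
    pairingP K k h (C c * a) = c * pairingP K k h a := by
  simp only [pairingP, coeff_C_mul, Finset.mul_sum]
  exact Finset.sum_congr rfl fun i _ => by ring

/-- The pairing as a linear map in the second variable. -/
noncomputable def oiPair (K : Type*) [Field K] (k : ℕ) (h : MvPolynomial (Fin 2) K) :
    MvPolynomial (Fin 2) K →ₗ[K] K where
  toFun g := pairingP K k h g
  map_add' := oi_pair_add_right k h
  map_smul' c a := by
    rw [MvPolynomial.smul_eq_C_mul]
    exact oi_pair_smul_right k h a c

/-- The star action as an algebra map. -/
noncomputable def oiStar (K : Type*) [Field K] (g : SL2Z) :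
    MvPolynomial (Fin 2) K →ₐ[K] MvPolynomial (Fin 2) K :=
  aeval ![C ((g.1 1 1 : ℤ) : K) * X 0 + C ((-(g.1 1 0) : ℤ) : K) * X 1,
          C ((-(g.1 0 1) : ℤ) : K) * X 0 + C ((g.1 0 0 : ℤ) : K) * X 1]

lemma oi_actStar {K : Type*} [Field K] (g : SL2Z) (h : MvPolynomial (Fin 2) K) :
    actStar K g h = oiStar K g h := by
  simp [actStar, substMat, oiStar]

lemma oi_lin_homog {K : Type*} [Field K] (s t : K) :
    (C s * X 0 + C t * X 1 : MvPolynomial (Fin 2) K).IsHomogeneous 1 := by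
  apply IsHomogeneous.add
  · simpa using (isHomogeneous_C (Fin 2) s).mul (isHomogeneous_X K (0 : Fin 2))
  · simpa using (isHomogeneous_C (Fin 2) t).mul (isHomogeneous_X K (1 : Fin 2))

lemma oi_star_homog {K : Type*} [Field K] (g : SL2Z) {n : ℕ} {h : MvPolynomial (Fin 2) K}
    (hh : h.IsHomogeneous n) : (oiStar K g h).IsHomogeneous n := by
  have key : ∀ i, (![C ((g.1 1 1 : ℤ) : K) * X 0 + C ((-(g.1 1 0) : ℤ) : K) * X 1,
      C ((-(g.1 0 1) : ℤ) : K) * X 0 + C ((g.1 0 0 : ℤ) : K) * X 1] i :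
        MvPolynomial (Fin 2) K).IsHomogeneous 1 := by
    rw [Fin.forall_fin_two]
    exact ⟨oi_lin_homog (K := K) ((g.1 1 1 : ℤ) : K) ((-(g.1 1 0) : ℤ) : K),
      oi_lin_homog (K := K) ((-(g.1 0 1) : ℤ) : K) ((g.1 0 0 : ℤ) : K)⟩
  have h2 := hh.aeval (n := 1) _ key
  rw [one_mul] at h2
  exact h2

lemma oi_det (g : SL2Z) : g.1 0 0 * g.1 1 1 - g.1 0 1 * g.1 1 0 = 1 := by
  have h2 : g.1.det = 1 := g.2
  rwa [Matrix.det_fin_two] at h2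

lemma oi_inv_pow {K : Type*} [Field K] [CharZero K] (k : ℕ) (hk : 1 ≤ k) (g : SL2Z)
    {h : MvPolynomial (Fin 2) K} (hh : h.IsHomogeneous (2 * k - 2)) (s t : K) :
    pairingP K k (oiStar K g h) (oiStar K g ((C s * X 0 + C t * X 1) ^ (2 * k - 2))) =
    pairingP K k h ((C s * X 0 + C t * X 1) ^ (2 * k - 2)) := by
  have e : oiStar K g ((C s * X 0 + C t * X 1) ^ (2 * k - 2)) =
      (C (s * (g.1 1 1 : K) - t * (g.1 0 1 : K)) * X 0 +
        C (t * (g.1 0 0 : K) - s * (g.1 1 0 : K)) * X 1) ^ (2 * k - 2) := by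
    rw [map_pow]
    congr 1
    simp [oiStar, algHom_C]
    ring
  have hd : (g.1 0 0 : K) * (g.1 1 1 : K) - (g.1 0 1 : K) * (g.1 1 0 : K) = 1 := by
    exact_mod_cast congrArg (Int.cast : ℤ → K) (oi_det g)
  rw [e, oi_pair_pow k hk (oi_star_homog g hh), oi_pair_pow k hk hh, oiStar,
    ← AlgHom.comp_apply]
  congr 1
  apply MvPolynomial.algHom_ext
  intro i
  fin_cases i
  · simp
    linear_combination (-t) * hd
  · simp
    linear_combination s * hd

lemma oi_invariant {K : Type*} [Field K] [CharZero K] (k : ℕ) (hk : 1 ≤ k) (γ : SL2Z)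
    {h g : MvPolynomial (Fin 2) K} (hh : h.IsHomogeneous (2 * k - 2))
    (hg : g.IsHomogeneous (2 * k - 2)) :
    pairingP K k (oiStar K γ h) (oiStar K γ g) = pairingP K k h g := by
  set n := 2 * k - 2 with hn
  let L : MvPolynomial (Fin 2) K →ₗ[K] K :=
    (oiPair K k (oiStar K γ h)).comp (oiStar K γ).toLinearMap - oiPair K k h
  have hLp : ∀ s : K, L ((C s * X 0 + C 1 * X 1) ^ n) = 0 := by
    intro s
    exact sub_eq_zero.2 (oi_inv_pow k hk γ hh s 1)
  let P : Polynomial K := ∑ m ∈ Finset.range (n + 1),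
    Polynomial.monomial m ((n.choose m : K) * L (X 0 ^ m * X 1 ^ (n - m)))
  have hP : P = 0 := by
    apply Polynomial.funext
    intro s
    rw [Polynomial.eval_zero, ← hLp s, oi_linpow, map_sum, Polynomial.eval_finsetSum]
    refine Finset.sum_congr rfl fun m _ => ?_
    rw [← MvPolynomial.smul_eq_C_mul, map_smul, Polynomial.eval_monomial, smul_eq_mul]
    ring
  have hLm : ∀ m ∈ Finset.range (n + 1), L (X 0 ^ m * X 1 ^ (n - m)) = 0 := by
    intro m hm
    have h1 : P.coeff m = (n.choose m : K) * L (X 0 ^ m * X 1 ^ (n - m)) := by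
      simp only [P, Polynomial.finsetSum_coeff, Polynomial.coeff_monomial]
      rw [Finset.sum_ite_eq' , if_pos hm]
    rw [hP, Polynomial.coeff_zero] at h1
    have hc : (n.choose m : K) ≠ 0 := by
      have hm' : m ≤ n := by simp at hm; omega
      exact_mod_cast (Nat.choose_pos hm').ne'
    rcases mul_eq_zero.1 h1.symm with h2 | h2
    · exact absurd h2 hc
    · exact h2
  have hLg : L g = 0 := by
    rw [oi_homog_sum hg, map_sum]
    refine Finset.sum_eq_zero fun m hm => ?_
    rw [← MvPolynomial.smul_eq_C_mul, map_smul, hLm m hm, smul_zero]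
  exact sub_eq_zero.1 hLg

lemma oi_bqf_star {K : Type*} [Field K] (Q : ℤ × ℤ × ℤ) (g : SL2Z) :
    bqfPoly K (starBQF Q g) = oiStar K g (bqfPoly K Q) := by
  have h2 : (C 2 : MvPolynomial (Fin 2) K) = 2 := map_ofNat C 2
  simp [bqfPoly, starBQF, oiStar, h2]
  ring

lemma oi_bqf_homog {K : Type*} [Field K] (Q : ℤ × ℤ × ℤ) (k : ℕ) :
    (bqfPoly K Q ^ (k - 1)).IsHomogeneous (2 * k - 2) := by
  have h2 : (bqfPoly K Q).IsHomogeneous 2 := by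
    have hc := fun c : K => isHomogeneous_C (Fin 2) c
    have hx := fun i : Fin 2 => isHomogeneous_X K i
    refine IsHomogeneous.add (IsHomogeneous.add ?_ ?_) ?_
    · simpa using (hc Q.1).mul ((hx 0).pow 2)
    · simpa using ((hc Q.2.1).mul (hx 0)).mul (hx 1)
    · simpa using (hc Q.2.2).mul ((hx 1).pow 2)
  have := h2.pow (k - 1)
  rwa [show 2 * (k - 1) = 2 * k - 2 by omega] at this

lemma oi_star_mul (Q : ℤ × ℤ × ℤ) (g h : SL2Z) :
    starBQF Q (g * h) = starBQF (starBQF Q g) h := by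
  simp only [starBQF, Matrix.SpecialLinearGroup.coe_mul, Matrix.mul_apply, Fin.sum_univ_two,
    Prod.mk.injEq]
  refine ⟨?_, ?_, ?_⟩ <;> ring

lemma oi_smul_mul (g h : SL2Z) (x : P1Q) : smulP1 (g * h) x = smulP1 g (smulP1 h x) := by
  induction x using Projectivization.ind with
  | h v hv =>
    simp only [smulP1, Projectivization.map_mk]
    congr 1
    simp [sl2LinEquiv]

/-- non-square-discriminant case of orbit-independence: if `γ₀ ∈ Γ₀(p)`
stabilizes `Q ∈ 𝓕_p` and `γ ∈ Γ₀(p)`, then `γ⁻¹γ₀γ` stabilizes `Q⋆γ` and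
`⟨μ{ω, (γ⁻¹γ₀γ)ω}, (Q⋆γ)^{k-1}⟩ = ⟨μ{ω′, γ₀ω′}, Q^{k-1}⟩`. -/
theorem orbit_independence_nonsquare (p k : ℕ) (hp : p.Prime) (hk : 1 ≤ k)
    (K : Type*) [Field K] [CharZero K]
    (μ : P1Q → P1Q → MvPolynomial (Fin 2) K)
    (hsym : ∀ r s t : P1Q, μ r s + μ s t = μ r t)
    (hval : ∀ r s : P1Q, (μ r s).IsHomogeneous (2 * k - 2))
    (hinv : ∀ γ : SL2Z, (p : ℤ) ∣ γ.1 1 0 →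
      ∀ r s : P1Q, actStar K γ (μ (smulP1 γ r) (smulP1 γ s)) = μ r s)
    (Q : ℤ × ℤ × ℤ) (hQ : memF p Q)
    (γ₀ : SL2Z) (hγ₀ : (p : ℤ) ∣ γ₀.1 1 0) (hfix : starBQF Q γ₀ = Q)
    (γ : SL2Z) (hγ : (p : ℤ) ∣ γ.1 1 0) :
    starBQF (starBQF Q γ) (γ⁻¹ * γ₀ * γ) = starBQF Q γ ∧
    ∀ ω ω' : P1Q,
      pairingP K k (μ ω (smulP1 (γ⁻¹ * γ₀ * γ) ω)) (bqfPoly K (starBQF Q γ) ^ (k - 1)) =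
        pairingP K k (μ ω' (smulP1 γ₀ ω')) (bqfPoly K Q ^ (k - 1)) := by
  have key : ∀ g : SL2Z, (p : ℤ) ∣ g.1 1 0 → ∀ r s : P1Q, ∀ R : ℤ × ℤ × ℤ,
      pairingP K k (μ r s) (bqfPoly K (starBQF R g) ^ (k - 1)) =
      pairingP K k (μ (smulP1 g r) (smulP1 g s)) (bqfPoly K R ^ (k - 1)) := by
    intro g hg r s R
    rw [← hinv g hg r s, oi_actStar, oi_bqf_star, ← map_pow]
    exact oi_invariant k hk g (hval _ _) (oi_bqf_homog R k)
  refine ⟨?_, ?_⟩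
  · rw [← oi_star_mul, show γ * (γ⁻¹ * γ₀ * γ) = γ₀ * γ by group, oi_star_mul, hfix]
  · intro ω ω'
    rw [key γ hγ, ← oi_smul_mul, show γ * (γ⁻¹ * γ₀ * γ) = γ₀ * γ by group, oi_smul_mul]
    set η := smulP1 γ ω
    have h1 := key γ₀ hγ₀ η ω' Q
    rw [hfix] at h1
    have h2 : μ η (smulP1 γ₀ η) + μ (smulP1 γ₀ η) (smulP1 γ₀ ω') =
        μ η ω' + μ ω' (smulP1 γ₀ ω') := by
      rw [hsym, hsym]
    have h3 := congrArg (fun f => pairingP K k f (bqfPoly K Q ^ (k - 1))) h2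
    simp only [oi_pair_add_left] at h3
    rw [← h1] at h3
    linear_combination h3
end
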